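/- arXiv:1211.0065 — 3 statements merged into one kernel-verified Lean document; each statement's English description precedes it below -/
import Mathlib

section
/- For N = 12 and k = 2, the minimal elements of the suborder SC_2 of the set classes 2^(ℤ_12)/ℤ_12 under the induced subset order are exactly the four transposition classes of the whole tone collection {0,2,4,6,8,10}, the diatonic collection {0,2,4,5,7,9,11}, the melodic minor collection {0,2,3,5,7,9,11}, and the octatonic collection {0,1,3,4,6,7,9,10}. -/
open scoped Pointwise

/-- The setoid on subsets of `ZMod 12` identifying transpositionally related
pitch class sets; its quotient is the space of set classes of `Tₙ`-type. -/
def transpSetoid (N : ℕ) : Setoid (Set (ZMod N)) :=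
  AddAction.orbitRel (ZMod N) (Set (ZMod N))

/-- The induced subset/superset partial order on set classes. -/
def classLE {N : ℕ} (A B : Quotient (transpSetoid N)) : Prop :=
  ∃ a b : Set (ZMod N), Quotient.mk (transpSetoid N) a = A ∧
    Quotient.mk (transpSetoid N) b = B ∧ a ⊆ b

/-- The scalar second (circular gap) of `a ⊆ ZMod N` starting at `x`. -/
noncomputable def gap {N : ℕ} (a : Set (ZMod N)) (x : ZMod N) : ℕ :=
  sInf {d : ℕ | 0 < d ∧ x + (d : ZMod N) ∈ a}

/-- A pitch class set lies in `SC_k` iff it is nonempty and all its scalar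
seconds span at most `k` semitones. -/
def InSC {N : ℕ} (k : ℕ) (a : Set (ZMod N)) : Prop :=
  a.Nonempty ∧ ∀ x ∈ a, gap a x ≤ k

/-- A set class lies in `SC_k` iff one of its representatives does. -/
def ClassInSC {N : ℕ} (k : ℕ) (A : Quotient (transpSetoid N)) : Prop :=
  ∃ a : Set (ZMod N), Quotient.mk (transpSetoid N) a = A ∧ InSC k a

/-- A set class `A ∈ SC_k` is minimal in the suborder `SC_k` iff there is no
`B ∈ SC_k` with `B ≤ A` and `B ≠ A`. -/
def MinimalInSC {N : ℕ} (k : ℕ) (A : Quotient (transpSetoid N)) : Prop :=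
  ClassInSC k A ∧ ∀ B : Quotient (transpSetoid N), ClassInSC k B → classLE B A → B = A

/-- A set class equality unfolds to a transposition between representatives. -/
theorem mk_transp_eq_iff {N : ℕ} {a b : Set (ZMod N)} :
    Quotient.mk (transpSetoid N) a = Quotient.mk (transpSetoid N) b ↔
      ∃ t : ZMod N, t +ᵥ b = a :=
  Quotient.eq.trans AddAction.orbitRel_apply

theorem gap_le_two_iff {N : ℕ} [NeZero N] {a : Set (ZMod N)} {x : ZMod N} (hx : x ∈ a) :
    gap a x ≤ 2 ↔ x + 1 ∈ a ∨ x + 2 ∈ a := by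
  constructor
  · intro h
    have hne : {d : ℕ | 0 < d ∧ x + (d : ZMod N) ∈ a}.Nonempty :=
      ⟨N, NeZero.pos N, by simpa using hx⟩
    obtain ⟨hpos, hmem⟩ := Nat.sInf_mem hne
    change 0 < gap a x at hpos
    change x + (gap a x : ZMod N) ∈ a at hmem
    generalize gap a x = d at h hpos hmem
    interval_cases d
    · exact Or.inl (by simpa using hmem)
    · exact Or.inr (by simpa using hmem)
  · rintro (h | h)
    · exact le_trans (Nat.sInf_le ⟨one_pos, by simpa using h⟩) one_le_two
    · exact Nat.sInf_le (m := 2) ⟨two_pos, by simpa using h⟩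

/-- The sets in `SC₂` are those that never omit two adjacent pitch classes. -/
theorem inSC_two_iff {N : ℕ} [NeZero N] {a : Set (ZMod N)} :
    InSC 2 a ↔ ∀ x, x ∈ a ∨ x + 1 ∈ a := by
  constructor
  · rintro ⟨⟨y, hy⟩, h⟩ x
    have key : ∀ n : ℕ, y + (n : ZMod N) ∈ a ∨ y + (n : ZMod N) + 1 ∈ a := by
      intro n
      induction n with
      | zero => exact Or.inl (by simpa using hy)
      | succ n ih =>
        rw [Nat.cast_succ, ← add_assoc]
        rcases ih with ih | ih
        · rcases (gap_le_two_iff ih).1 (h _ ih) with h' | h'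
          · exact Or.inl h'
          · exact Or.inr (by rwa [add_assoc _ 1 1, one_add_one_eq_two])
        · exact Or.inl ih
    simpa using key (x - y).val
  · intro h
    refine ⟨(h 0).elim Set.nonempty_of_mem Set.nonempty_of_mem, fun x hx => (gap_le_two_iff hx).2 ?_⟩
    simpa [add_assoc, one_add_one_eq_two] using h (x + 1)

theorem InSC.vadd {N : ℕ} [NeZero N] {a : Set (ZMod N)} (h : InSC 2 a) (t : ZMod N) :
    InSC 2 (t +ᵥ a) := by
  rw [inSC_two_iff] at h ⊢
  intro x
  simpa [Set.mem_vadd_set_iff_neg_vadd_mem, add_assoc] using h (-t + x)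

theorem classInSC_mk {N : ℕ} [NeZero N] {a : Set (ZMod N)} :
    ClassInSC 2 (Quotient.mk (transpSetoid N) a) ↔ InSC 2 a := by
  refine ⟨?_, fun h => ⟨a, rfl, h⟩⟩
  rintro ⟨b, hb, h⟩
  obtain ⟨t, rfl⟩ := mk_transp_eq_iff.1 hb.symm
  exact h.vadd t

/-- The class of a set is minimal in `SC₂` iff the set omits no two adjacent pitch classes and
contains no three consecutive ones. -/
theorem minimalInSC_mk {N : ℕ} [NeZero N] [Fact (1 < N)] {a : Set (ZMod N)} :
    MinimalInSC 2 (Quotient.mk (transpSetoid N) a) ↔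
      ∀ x, (x ∈ a ∨ x + 1 ∈ a) ∧ ¬ (x ∈ a ∧ x + 1 ∈ a ∧ x + 2 ∈ a) := by
  rw [MinimalInSC, classInSC_mk, forall_and, inSC_two_iff]
  refine and_congr_right fun ha => ⟨fun hmin x ⟨h0, h1, h2⟩ => ?_, fun hthree B hB hle => ?_⟩
  · have hb : InSC 2 (a \ {x + 1}) := by
      rw [inSC_two_iff]
      intro y
      by_cases hy : y = x + 1
      · subst hy
        right
        rw [add_assoc, one_add_one_eq_two]
        exact ⟨h2, fun h => one_ne_zero (α := ZMod N) (by
          linear_combination Set.mem_singleton_iff.1 h)⟩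
      by_cases hyx : y = x
      · subst hyx
        exact Or.inl ⟨h0, hy⟩
      · exact (ha y).imp (fun h => ⟨h, hy⟩) fun h => ⟨h, by simpa using hyx⟩
    obtain ⟨t, ht⟩ := mk_transp_eq_iff.1
      (hmin _ (classInSC_mk.2 hb) ⟨_, _, rfl, rfl, Set.sdiff_subset⟩)
    have hcard : (a \ {x + 1}).ncard = a.ncard := by rw [← ht, Set.ncard_vadd_set]
    exact (Set.ncard_sdiff_singleton_lt_of_mem h1).ne hcard
  · obtain ⟨b, c, rfl, hc, hbc⟩ := hle
    obtain ⟨t, rfl⟩ := mk_transp_eq_iff.1 hc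
    rw [classInSC_mk, inSC_two_iff] at hB
    refine hc ▸ congrArg _ (hbc.antisymm fun x hx => ?_)
    by_contra hxb
    have hpred : x - 1 ∈ b := (hB (x - 1)).resolve_right (by simpa using hxb)
    have hsucc : x + 1 ∈ b := (hB x).resolve_left hxb
    have hp := hbc hpred
    have hs := hbc hsucc
    simp only [Set.mem_vadd_set_iff_neg_vadd_mem, vadd_eq_add] at hx hp hs
    refine hthree (-t + (x - 1)) ⟨hp, ?_, ?_⟩
    · convert hx using 1; ring
    · convert hs using 1; ring

/-- The set with characteristic function `p` omits no two adjacent pitch classes and contains no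
three consecutive ones. -/
def IsMinimalPattern (p : ZMod 12 → Bool) : Prop :=
  ∀ x, (p x ∨ p (x + 1)) ∧ ¬ (p x ∧ p (x + 1) ∧ p (x + 2))

instance : DecidablePred IsMinimalPattern := fun p => by
  unfold IsMinimalPattern
  infer_instance

/-- The set with characteristic function `p` is a transposition of `s`. -/
def IsTranspositionOf (s : Finset (ZMod 12)) (p : ZMod 12 → Bool) : Prop :=
  ∃ t, ∀ x, -t + x ∈ s ↔ p x

instance (s : Finset (ZMod 12)) : DecidablePred (IsTranspositionOf s) := fun p => by
  unfold IsTranspositionOf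
  infer_instance

/-- The characteristic function with the given list of values. -/
def characteristicFunction (b₀ b₁ b₂ b₃ b₄ b₅ b₆ b₇ b₈ b₉ b₁₀ b₁₁ : Bool) : ZMod 12 → Bool :=
  ![b₀, b₁, b₂, b₃, b₄, b₅, b₆, b₇, b₈, b₉, b₁₀, b₁₁]

theorem IsMinimalPattern.isTranspositionOf {p : ZMod 12 → Bool} (h : IsMinimalPattern p) :
    IsTranspositionOf {0, 2, 4, 6, 8, 10} p ∨
      IsTranspositionOf {0, 2, 4, 5, 7, 9, 11} p ∨
      IsTranspositionOf {0, 2, 3, 5, 7, 9, 11} p ∨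
      IsTranspositionOf {0, 1, 3, 4, 6, 7, 9, 10} p := by
  have hp : p = characteristicFunction (p 0) (p 1) (p 2) (p 3) (p 4) (p 5) (p 6) (p 7) (p 8) (p 9)
      (p 10) (p 11) := by
    funext x
    fin_cases x <;> rfl
  rw [hp] at h ⊢
  generalize p 0 = b₀, p 1 = b₁, p 2 = b₂, p 3 = b₃, p 4 = b₄, p 5 = b₅, p 6 = b₆, p 7 = b₇,
    p 8 = b₈, p 9 = b₉, p 10 = b₁₀, p 11 = b₁₁ at h ⊢
  clear hp p
  revert b₀ b₁ b₂ b₃ b₄ b₅ b₆ b₇ b₈ b₉ b₁₀ b₁₁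
  decide +kernel

/-- The minimal elements of the suborder `SC₂` of the set classes of
`2^(ℤ₁₂)/ℤ₁₂` are exactly the classes of the whole tone, diatonic, melodic
minor, and octatonic collections. -/
theorem minimal_SC2_classification (A : Quotient (transpSetoid 12)) :
    MinimalInSC 2 A ↔
      (A = Quotient.mk (transpSetoid 12) ({0, 2, 4, 6, 8, 10} : Set (ZMod 12)) ∨
       A = Quotient.mk (transpSetoid 12) ({0, 2, 4, 5, 7, 9, 11} : Set (ZMod 12)) ∨
       A = Quotient.mk (transpSetoid 12) ({0, 2, 3, 5, 7, 9, 11} : Set (ZMod 12)) ∨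
       A = Quotient.mk (transpSetoid 12) ({0, 1, 3, 4, 6, 7, 9, 10} : Set (ZMod 12))) := by
  have : Fact (1 < 12) := ⟨by norm_num⟩
  constructor
  · induction A using Quotient.inductionOn with | _ a
    intro h
    rw [minimalInSC_mk] at h
    classical
    have hp : IsMinimalPattern fun x => decide (x ∈ a) := by
      simpa only [IsMinimalPattern, decide_eq_true_eq] using h
    simpa only [mk_transp_eq_iff, IsTranspositionOf,
      Set.ext_iff, Set.mem_vadd_set_iff_neg_vadd_mem, vadd_eq_add, Set.mem_insert_iff,
      Set.mem_singleton_iff, decide_eq_true_eq, Finset.mem_insert, Finset.mem_singleton]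
      using hp.isTranspositionOf
  · rintro (rfl | rfl | rfl | rfl) <;> rw [minimalInSC_mk] <;>
      simp only [Set.mem_insert_iff, Set.mem_singleton_iff] <;> decide
end

section
/- Let b and p be timbral vectors of length n, and let x be any solution of the constrained minimization problem: minimize ‖x − p‖₁ over timbral vectors x subject to x ⪯ b in the brighter-than order. Then x ⪯ b ∧ p, where b ∧ p is the infimum of b and p in the brighter-than order. -/
open Finset

/-- A timbral vector: a probability vector in `ℝⁿ`, the proportion of total
signal power in each harmonic. -/
def IsTimbral {n : ℕ} (a : Fin n → ℝ) : Prop :=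
  (∀ i, 0 ≤ a i) ∧ ∑ i, a i = 1

/-- The total power in the harmonics from `k` on: `Σ_{i=k}^{n} a_i`. -/
def tailSum {n : ℕ} (a : Fin n → ℝ) (k : Fin n) : ℝ :=
  ∑ i ∈ Finset.univ.filter (fun i => k ≤ i), a i

/-- The brighter-than order: `b` is brighter than `a`, written `Brighter a b`
(for `a ⪯ b`), iff for every `k`, `Σ_{i=k}^{n} a_i ≤ Σ_{i=k}^{n} b_i`. -/
def Brighter {n : ℕ} (a b : Fin n → ℝ) : Prop :=
  ∀ k : Fin n, tailSum a k ≤ tailSum b k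

/-- The ℓ¹ norm `‖y‖₁ = Σ_i |y_i|`. -/
def l1norm {n : ℕ} (y : Fin n → ℝ) : ℝ :=
  ∑ i, |y i|

/-- Moving an amount `ε` of power from the harmonic `i` to the harmonic `j`. -/
def transfer {n : ℕ} (x : Fin n → ℝ) (i j : Fin n) (ε : ℝ) (l : Fin n) : ℝ :=
  x l + (if l = j then ε else 0) - (if l = i then ε else 0)

lemma sum_transfer {n : ℕ} (x : Fin n → ℝ) (i j : Fin n) (ε : ℝ) :
    ∑ l, transfer x i j ε l = ∑ l, x l := by
  simp [transfer, Finset.sum_add_distrib, Finset.sum_sub_distrib]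

lemma isTimbral_transfer {n : ℕ} {x : Fin n → ℝ} (hx : IsTimbral x) {i j : Fin n} {ε : ℝ}
    (hε : 0 ≤ ε) (hi : ε ≤ x i) : IsTimbral (transfer x i j ε) := by
  refine ⟨fun l => ?_, (sum_transfer x i j ε).trans hx.2⟩
  have hl := hx.1 l
  by_cases h : l = i
  · subst h
    simp only [transfer, if_true]
    split_ifs <;> linarith
  · simp only [transfer, if_neg h]
    split_ifs <;> linarith

/-- Moving power to a lower harmonic makes a vector less bright. -/
lemma brighter_transfer {n : ℕ} (x : Fin n → ℝ) {i j : Fin n} (hji : j ≤ i) {ε : ℝ}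
    (hε : 0 ≤ ε) : Brighter (transfer x i j ε) x := by
  intro k
  simp only [tailSum, transfer, Finset.sum_add_distrib, Finset.sum_sub_distrib,
    Finset.sum_ite_eq', Finset.mem_filter, Finset.mem_univ, true_and]
  split_ifs with hj hi
  · linarith
  · exact absurd (hj.trans hji) hi
  · linarith
  · linarith

/-- Moving power from a harmonic where `x` exceeds `p` to one where it falls short of `p`
brings `x` strictly closer to `p`. -/
lemma l1norm_transfer_sub_lt {n : ℕ} {x p : Fin n → ℝ} {i j : Fin n} (hij : i ≠ j) {ε : ℝ}
    (hε : 0 < ε) (hi : ε ≤ x i - p i) (hj : ε ≤ p j - x j) :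
    l1norm (transfer x i j ε - p) < l1norm (x - p) := by
  have hlt : |(transfer x i j ε - p) i| < |(x - p) i| := by
    simp only [Pi.sub_apply, transfer, if_neg hij, if_true]
    rw [abs_of_nonneg (by linarith), abs_of_nonneg (by linarith)]
    linarith
  refine Finset.sum_lt_sum (fun l _ => ?_) ⟨i, Finset.mem_univ i, hlt⟩
  by_cases h : l = i
  · exact h ▸ hlt.le
  by_cases h' : l = j
  · subst h'
    simp only [Pi.sub_apply, transfer, if_neg h, if_true]
    rw [abs_of_nonpos (by linarith), abs_of_nonpos (by linarith)]
    linarith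
  · simp [transfer, h, h']

lemma exists_lt_of_tailSum_lt {n : ℕ} {x p : Fin n → ℝ} (hsum : ∑ l, x l = ∑ l, p l)
    {k : Fin n} (hk : tailSum p k < tailSum x k) :
    ∃ i j, j < i ∧ p i < x i ∧ x j < p j := by
  obtain ⟨i, hi, hpi⟩ := Finset.exists_lt_of_sum_lt hk
  have hlow : ∑ l ∈ Finset.univ.filter (fun l => ¬ k ≤ l), x l <
      ∑ l ∈ Finset.univ.filter (fun l => ¬ k ≤ l), p l := by
    have h₁ := Finset.sum_filter_add_sum_filter_not Finset.univ (fun l => k ≤ l) x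
    have h₂ := Finset.sum_filter_add_sum_filter_not Finset.univ (fun l => k ≤ l) p
    unfold tailSum at hk
    linarith
  obtain ⟨j, hj, hpj⟩ := Finset.exists_lt_of_sum_lt hlow
  simp only [Finset.mem_filter, Finset.mem_univ, true_and, not_le] at hi hj
  exact ⟨i, j, hj.trans_le hi, hpi, hpj⟩

/-- Any solution `x` of the problem "minimize `‖x − p‖₁` over timbral vectors
`x` with `x ⪯ b`" satisfies `x ⪯ b ∧ p`, where `b ∧ p` is the infimum of `b`
and `p` in the brighter-than order (the vector `z` whose tail sums are the
minima of those of `b` and `p`). -/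
theorem solution_le_inf {n : ℕ} (b p x z : Fin n → ℝ)
    (hb : IsTimbral b) (hp : IsTimbral p) (hx : IsTimbral x)
    (hz : ∀ k : Fin n, tailSum z k = min (tailSum b k) (tailSum p k))
    (hxb : Brighter x b)
    (hmin : ∀ x' : Fin n → ℝ, IsTimbral x' → Brighter x' b →
      l1norm (x - p) ≤ l1norm (x' - p)) :
    Brighter x z := by
  intro k
  rw [hz k]
  refine le_min (hxb k) (le_of_not_gt fun hk => ?_)
  obtain ⟨i, j, hji, hi, hj⟩ := exists_lt_of_tailSum_lt (hx.2.trans hp.2.symm) hk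
  have hε : 0 < min (x i - p i) (p j - x j) := lt_min (sub_pos.2 hi) (sub_pos.2 hj)
  have hεi := min_le_left (x i - p i) (p j - x j)
  have hεj := min_le_right (x i - p i) (p j - x j)
  refine (l1norm_transfer_sub_lt hji.ne' hε hεi hεj).not_ge (hmin _ ?_ fun m => ?_)
  · exact isTimbral_transfer hx hε.le (by linarith [hp.1 i])
  · exact (brighter_transfer x hji.le hε.le m).trans (hxb m)
end

section
/- Let b and p be timbral vectors of length n, and let z ∈ ℝⁿ be the unique vector satisfying Σ_{i=k}^{n} z_i = min(Σ_{i=k}^{n} b_i, Σ_{i=k}^{n} p_i) for every k ∈ {1, …, n}. Then z is itself a timbral vector (its entries are nonnegative and sum to 1), z ⪯ b and z ⪯ p in the brighter-than order, and z is the greatest lower bound of b and p: every timbral vector w with w ⪯ b and w ⪯ p satisfies w ⪯ z. -/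
open Finset

theorem tailSum_eq_add_sum_lt {n : ℕ} (a : Fin n → ℝ) (k : Fin n) :
    tailSum a k = a k + ∑ i ∈ univ.filter (fun i => k < i), a i := by
  have h : univ.filter (fun i => k ≤ i) = insert k (univ.filter (fun i => k < i)) := by
    ext i
    simp [le_iff_eq_or_lt, eq_comm]
  rw [tailSum, h, sum_insert (by simp)]

theorem tailSum_of_isLast {n : ℕ} (a : Fin n → ℝ) (k : Fin n) (hk : n ≤ k.val + 1) :
    tailSum a k = a k := by
  rw [tailSum_eq_add_sum_lt, filter_false_of_mem, sum_empty, add_zero]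
  intro i _
  rw [Fin.lt_def]
  omega

theorem tailSum_eq_add_tailSum_succ {n : ℕ} (a : Fin n → ℝ) (k : Fin n) (hk : k.val + 1 < n) :
    tailSum a k = a k + tailSum a ⟨k.val + 1, hk⟩ := by
  rw [tailSum_eq_add_sum_lt, tailSum]
  simp only [Fin.lt_def, Fin.le_def, Nat.succ_le_iff]

theorem tailSum_zero {n : ℕ} (a : Fin n → ℝ) (hn : 0 < n) : tailSum a ⟨0, hn⟩ = ∑ i, a i := by
  simp [tailSum, Fin.le_def]

/-- The vector `z` whose tail sums are the minima of the tail sums of the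
timbral vectors `b` and `p` is itself a timbral vector, satisfies `z ⪯ b` and
`z ⪯ p`, and is the greatest lower bound of `b` and `p` in the brighter-than
order. -/
theorem inf_is_glb {n : ℕ} (b p z : Fin n → ℝ)
    (hb : IsTimbral b) (hp : IsTimbral p)
    (hz : ∀ k : Fin n, tailSum z k = min (tailSum b k) (tailSum p k)) :
    IsTimbral z ∧ Brighter z b ∧ Brighter z p ∧
    ∀ w : Fin n → ℝ, IsTimbral w → Brighter w b → Brighter w p → Brighter w z := by
  refine ⟨⟨fun k => ?_, ?_⟩, fun k => (hz k).trans_le (min_le_left _ _),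
    fun k => (hz k).trans_le (min_le_right _ _),
    fun w _ hwb hwp k => (le_min (hwb k) (hwp k)).trans_eq (hz k).symm⟩
  · have hbk := hb.1 k
    have hpk := hp.1 k
    have hzk := hz k
    by_cases hk : k.val + 1 < n
    · have hzs := hz ⟨k.val + 1, hk⟩
      simp only [tailSum_eq_add_tailSum_succ _ k hk] at hzk
      have h : tailSum z ⟨k.val + 1, hk⟩ ≤ z k + tailSum z ⟨k.val + 1, hk⟩ := by
        rw [hzk, hzs]
        exact min_le_min (by linarith) (by linarith)
      linarith
    · simp only [tailSum_of_isLast _ k (not_lt.mp hk)] at hzk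
      exact hzk ▸ le_min hbk hpk
  · have hn : 0 < n := by
      rcases Nat.eq_zero_or_pos n with rfl | h
      · simpa using hb.2
      · exact h
    simpa only [tailSum_zero, hb.2, hp.2, min_self] using hz ⟨0, hn⟩
end
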